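/- One has T ∩ 𝓑 = ⋃_{w∈W} w(Π). In particular, the set W·Π = ⋃_{w∈W} w(Π) is convex. -/

import Mathlib

noncomputable section

abbrev V : Type := Fin 9 → ℝ

/-- The hyperplane class `H`. -/
def Hv : V := fun j => if j = 0 then 1 else 0

/-- The exceptional classes `E_1, …, E_8` (indexed by `Fin 8`). -/
def Ev (i : Fin 8) : V := fun j => if j = i.succ then 1 else 0

/-- The class `(d; m_1, …, m_8) = d·H − ∑ m_i·E_i`. -/
def cls (d : ℝ) (m : Fin 8 → ℝ) : V := d • Hv - ∑ i : Fin 8, m i • Ev i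

/-- The symmetric bilinear form with `(H,H) = 2`, `(E_i,E_j) = −δ_{ij}`, `(H,E_i) = 0`. -/
def form (x y : V) : ℝ := 2 * x 0 * y 0 - ∑ i : Fin 8, x i.succ * y i.succ

/-- The canonical class `K = −4H + 2∑ E_i`. -/
def Kv : V := (-4 : ℝ) • Hv + (2 : ℝ) • ∑ i : Fin 8, Ev i

/-- The simple roots `α_0, …, α_7`:  `α_0 = H − E_1 − E_2 − E_3 − E_4` and
`α_i = E_i − E_{i+1}` for `i = 1, …, 7`. -/
def α (i : Fin 8) : V :=
  if i = 0 then Hv - Ev 0 - Ev 1 - Ev 2 - Ev 3 else Ev (i - 1) - Ev i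

lemma form_add_right (a x y : V) : form a (x + y) = form a x + form a y := by
  simp only [form, Pi.add_apply, mul_add, Finset.sum_add_distrib]; ring

lemma form_smul_right (a : V) (c : ℝ) (x : V) : form a (c • x) = c * form a x := by
  unfold form
  simp only [Pi.smul_apply, smul_eq_mul]
  rw [show ∑ i : Fin 8, a i.succ * (c * x i.succ)
      = c * ∑ i : Fin 8, a i.succ * x i.succ from by
    rw [Finset.mul_sum]; exact Finset.sum_congr rfl fun i _ => by ring]
  ring

/-- The reflection `x ↦ x + (a, x)·a` as a linear map. -/
def reflLin (a : V) : V →ₗ[ℝ] V where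
  toFun x := x + form a x • a
  map_add' x y := by simp only [form_add_right, add_smul]; abel
  map_smul' c x := by
    simp only [form_smul_right, RingHom.id_apply, smul_add, smul_smul]

lemma form_alpha_self (i : Fin 8) : form (α i) (α i) = -2 := by
  fin_cases i <;>
    simp +decide [form, α, Hv, Ev, Fin.sum_univ_eight] <;> norm_num

lemma refl_refl (a : V) (h : form a a = -2) (x : V) :
    reflLin a (reflLin a x) = x := by
  show (x + form a x • a) + form a (x + form a x • a) • a = x
  rw [form_add_right, form_smul_right, h]
  module

/-- The simple reflections `s_0, …, s_7` as linear automorphisms of `V`. -/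
def sEquiv (i : Fin 8) : V ≃ₗ[ℝ] V :=
  LinearEquiv.ofLinear (reflLin (α i)) (reflLin (α i))
    (LinearMap.ext fun x => refl_refl _ (form_alpha_self i) x)
    (LinearMap.ext fun x => refl_refl _ (form_alpha_self i) x)

/-- The Weyl group `W`, the subgroup of `GL(V)` generated by `s_0, …, s_7`. -/
def W : Subgroup (V ≃ₗ[ℝ] V) := Subgroup.closure (Set.range sEquiv)

/-- Membership in the convex cone generated by a set `S ⊆ V`. -/
def inCone (S : Set V) (x : V) : Prop :=
  ∃ (n : ℕ) (c : Fin n → ℝ) (g : Fin n → V),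
    (∀ i, 0 ≤ c i) ∧ (∀ i, g i ∈ S) ∧ x = ∑ i, c i • g i

/-- The generators of the cone `Π` from Lemma `lem:standardinPi`. -/
def PiGens : Set V :=
  {Hv}
  ∪ {x | ∃ i : Fin 8, i.1 < 3 ∧ x = Hv - Ev i}
  ∪ {x | ∃ i j : Fin 8, i < j ∧ j.1 < 3 ∧ x = Hv - Ev i - Ev j}
  ∪ {x | ∃ k : ℕ, 4 ≤ k ∧ k ≤ 8 ∧
      x = (2 : ℝ) • Hv - ∑ i ∈ Finset.univ.filter (fun i : Fin 8 => i.1 < k), Ev i}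
  ∪ {x | ∃ l : ℕ, 4 ≤ l ∧ l ≤ 8 ∧
      x = (3 : ℝ) • Hv - (3 : ℝ) • Ev 0
          - ∑ i ∈ Finset.univ.filter (fun i : Fin 8 => 1 ≤ i.1 ∧ i.1 < l), Ev i}

/-- The cone `Π`, i.e. the convex cone generated by `PiGens`. -/
def PiCone : Set V := {x | inCone PiGens x}

/-- The closed fundamental chamber `C̄ = {x | (x, α_i) ≥ 0 for all i}`. -/
def Cbar : Set V := {x | ∀ i : Fin 8, 0 ≤ form x (α i)}

/-- The set `B = {(d; m_1, …, m_8) | 0 ≤ m_i ≤ d for all i}`; here the `i`-th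
multiplicity of `x` is `-x i.succ` and the degree is `x 0`. -/
def Bset : Set V := {x | ∀ i : Fin 8, 0 ≤ -x i.succ ∧ -x i.succ ≤ x 0}

/-- The orbit `W·E_8` of the exceptional class `E_8` under the Weyl group. -/
def orbitE8 : Set V := {x | ∃ w : V ≃ₗ[ℝ] V, w ∈ W ∧ x = w (Ev 7)}

/-! ### Coordinates -/

/-- The isotropic class `δ = -K/2 = 2H - ∑ E_i`, which spans the radical of the root lattice. -/
def delta : V := (2 : ℝ) • Hv - ∑ i : Fin 8, Ev i

lemma form_eq (x y : V) : form x y = 2 * x 0 * y 0 - (x 1 * y 1 + x 2 * y 2 + x 3 * y 3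
    + x 4 * y 4 + x 5 * y 5 + x 6 * y 6 + x 7 * y 7 + x 8 * y 8) := by
  simp only [form, Fin.sum_univ_eight]; rfl

lemma form_comm (x y : V) : form x y = form y x := by
  simp only [form_eq]; ring

lemma form_add_left (x y a : V) : form (x + y) a = form x a + form y a := by
  rw [form_comm, form_add_right, form_comm a x, form_comm a y]

lemma form_smul_left (c : ℝ) (x a : V) : form (c • x) a = c * form x a := by
  rw [form_comm, form_smul_right, form_comm]

lemma form_delta (x : V) :
    form x delta = 4 * x 0 + (x 1 + x 2 + x 3 + x 4 + x 5 + x 6 + x 7 + x 8) := by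
  simp +decide [form_eq, delta, Hv, Ev, Fin.sum_univ_eight]; ring

lemma form_alpha_zero (x : V) : form x (α 0) = 2 * x 0 + x 1 + x 2 + x 3 + x 4 := by
  simp +decide [form_eq, α, Hv, Ev]; ring

lemma form_alpha_of_ne (x : V) (i : Fin 8) (hi : i ≠ 0) :
    form x (α i) = x i.succ - x i.castSucc := by
  fin_cases i <;> first | exact absurd rfl hi | (simp +decide [form_eq, α, Ev]; try ring)

lemma mem_Cbar_iff (x : V) : x ∈ Cbar ↔ 0 ≤ 2 * x 0 + x 1 + x 2 + x 3 + x 4 ∧ x 1 ≤ x 2 ∧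
    x 2 ≤ x 3 ∧ x 3 ≤ x 4 ∧ x 4 ≤ x 5 ∧ x 5 ≤ x 6 ∧ x 6 ≤ x 7 ∧ x 7 ≤ x 8 := by
  have h (i : Fin 8) (hi : i ≠ 0) : 0 ≤ form x (α i) ↔ x i.castSucc ≤ x i.succ := by
    rw [form_alpha_of_ne x i hi, sub_nonneg]
  have h' : x ∈ Cbar ↔ ∀ i : Fin 8, 0 ≤ form x (α i) := Iff.rfl
  rw [h', Fin.forall_fin_succ, form_alpha_zero]
  refine and_congr_right fun _ => ?_
  rw [forall_congr' fun i : Fin 7 => h i.succ (Fin.succ_ne_zero i)]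
  simp only [Fin.forall_fin_succ, IsEmpty.forall_iff, and_true]
  rfl

lemma mem_Bset_iff (x : V) : x ∈ Bset ↔ ∀ i : Fin 8, x i.succ ≤ 0 ∧ 0 ≤ x 0 + x i.succ := by
  refine forall_congr' fun i => and_congr neg_nonneg ?_
  rw [neg_le_iff_add_nonneg]

lemma delta_mem_Cbar (t : ℝ) : t • delta ∈ Cbar := by
  rw [mem_Cbar_iff]
  simp +decide [delta, Hv, Ev, Fin.sum_univ_eight]
  linarith

/-! ### The Weyl group -/

lemma sEquiv_apply (i : Fin 8) (x : V) : sEquiv i x = x + form (α i) x • α i := rfl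

lemma sEquiv_mem (i : Fin 8) : sEquiv i ∈ W := Subgroup.subset_closure ⟨i, rfl⟩

lemma sEquiv_sEquiv (i : Fin 8) (x : V) : sEquiv i (sEquiv i x) = x :=
  refl_refl _ (form_alpha_self i) x

lemma sEquiv_mul_self (i : Fin 8) : sEquiv i * sEquiv i = 1 :=
  LinearEquiv.ext fun x => sEquiv_sEquiv i x

lemma sEquiv_alpha (i : Fin 8) : sEquiv i (α i) = -α i := by
  rw [sEquiv_apply, form_alpha_self]; module

lemma form_sEquiv (i : Fin 8) (x y : V) : form (sEquiv i x) (sEquiv i y) = form x y := by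
  simp only [sEquiv_apply, form_add_right, form_add_left, form_smul_right, form_smul_left,
    form_alpha_self]
  rw [form_comm x (α i)]; ring

/-- The element of `W` spelled by a word in the simple reflections. -/
def word (l : List (Fin 8)) : V ≃ₗ[ℝ] V := (l.map sEquiv).prod

lemma word_cons (i : Fin 8) (l : List (Fin 8)) : word (i :: l) = sEquiv i * word l := by
  simp [word]

lemma word_append (l l' : List (Fin 8)) : word (l ++ l') = word l * word l' := by
  simp [word]

lemma word_singleton (i : Fin 8) : word [i] = sEquiv i := by simp [word]

lemma word_mul_word_reverse (l : List (Fin 8)) : word l * word l.reverse = 1 := by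
  induction l with
  | nil => rfl
  | cons i l ih =>
    rw [List.reverse_cons, word_append, word_singleton, word_cons, mul_assoc,
      ← mul_assoc (word l), ih, one_mul, sEquiv_mul_self]

lemma exists_word {w : V ≃ₗ[ℝ] V} (hw : w ∈ W) : ∃ l, w = word l := by
  induction hw using Subgroup.closure_induction with
  | mem x hx => obtain ⟨i, rfl⟩ := hx; exact ⟨[i], (word_singleton i).symm⟩
  | one => exact ⟨[], rfl⟩
  | mul x y _ _ hx hy =>
    obtain ⟨l, rfl⟩ := hx
    obtain ⟨l', rfl⟩ := hy
    exact ⟨l ++ l', (word_append l l').symm⟩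
  | inv x _ hx =>
    obtain ⟨l, rfl⟩ := hx
    exact ⟨l.reverse, inv_eq_of_mul_eq_one_right (word_mul_word_reverse l)⟩

lemma form_word (l : List (Fin 8)) (x y : V) : form (word l x) (word l y) = form x y := by
  induction l with
  | nil => rfl
  | cons i l ih => rw [word_cons]; exact (form_sEquiv i _ _).trans ih

lemma form_map {w : V ≃ₗ[ℝ] V} (hw : w ∈ W) (x y : V) : form (w x) (w y) = form x y := by
  obtain ⟨l, rfl⟩ := exists_word hw
  exact form_word l x y

lemma form_alpha_delta (i : Fin 8) : form (α i) delta = 0 := by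
  rw [form_delta]
  fin_cases i <;> (simp +decide [α, Hv, Ev]; try norm_num)

lemma map_delta {w : V ≃ₗ[ℝ] V} (hw : w ∈ W) : w delta = delta := by
  obtain ⟨l, rfl⟩ := exists_word hw
  clear hw
  induction l with
  | nil => rfl
  | cons i l ih =>
    rw [word_cons, LinearEquiv.mul_apply, ih, sEquiv_apply, form_alpha_delta, zero_smul, add_zero]

lemma form_map_delta {w : V ≃ₗ[ℝ] V} (hw : w ∈ W) (x : V) :
    form (w x) delta = form x delta := by
  conv_lhs => rw [← map_delta hw]
  exact form_map hw x delta

/-! ### Integral classes and roots -/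

/-- The class `v` has integral coordinates. -/
def IsIntegralClass (v : V) : Prop := ∀ j, v j ∈ (Int.castRingHom ℝ).range

lemma IsIntegralClass.form_mem {x y : V} (hx : IsIntegralClass x) (hy : IsIntegralClass y) :
    form x y ∈ (Int.castRingHom ℝ).range :=
  sub_mem (mul_mem (mul_mem ⟨2, by simp⟩ (hx 0)) (hy 0))
    (sum_mem fun i _ => mul_mem (hx i.succ) (hy i.succ))

lemma isIntegralClass_alpha (i : Fin 8) : IsIntegralClass (α i) := by
  have hE (i : Fin 8) : IsIntegralClass (Ev i) := fun j => by
    unfold Ev; split_ifs <;> simp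
  have hH : IsIntegralClass Hv := fun j => by
    unfold Hv; split_ifs <;> simp
  intro j
  unfold α
  split_ifs
  · exact sub_mem (sub_mem (sub_mem (sub_mem (hH j) (hE 0 j)) (hE 1 j)) (hE 2 j)) (hE 3 j)
  · exact sub_mem (hE _ j) (hE _ j)

lemma IsIntegralClass.word {x : V} (hx : IsIntegralClass x) (l : List (Fin 8)) :
    IsIntegralClass (word l x) := by
  induction l with
  | nil => exact hx
  | cons i l ih =>
    rw [word_cons]
    exact fun j => add_mem (ih j)
      (mul_mem ((isIntegralClass_alpha i).form_mem ih) (isIntegralClass_alpha i j))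

/-- The coefficients of a class orthogonal to `δ` in the basis of simple roots. -/
def rootCoeff (v : V) : Fin 8 → ℝ :=
  ![v 0, v 0 + v 1, 2 * v 0 + v 1 + v 2, 3 * v 0 + v 1 + v 2 + v 3,
    4 * v 0 + v 1 + v 2 + v 3 + v 4, 4 * v 0 + v 1 + v 2 + v 3 + v 4 + v 5,
    4 * v 0 + v 1 + v 2 + v 3 + v 4 + v 5 + v 6,
    4 * v 0 + v 1 + v 2 + v 3 + v 4 + v 5 + v 6 + v 7]

lemma rootCoeff_add (x y : V) : rootCoeff (x + y) = rootCoeff x + rootCoeff y := by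
  ext i; fin_cases i <;> simp [rootCoeff] <;> ring

lemma rootCoeff_smul (c : ℝ) (x : V) : rootCoeff (c • x) = c • rootCoeff x := by
  ext i; fin_cases i <;> simp [rootCoeff] <;> ring

lemma rootCoeff_neg (x : V) : rootCoeff (-x) = -rootCoeff x := by
  ext i; fin_cases i <;> simp [rootCoeff] <;> ring

lemma rootCoeff_alpha (i : Fin 8) : rootCoeff (α i) = Pi.single i 1 := by
  ext j
  fin_cases i <;> fin_cases j <;> simp +decide [rootCoeff, α, Hv, Ev] <;> norm_num

lemma eq_of_rootCoeff_eq {x y : V} (hx : form x delta = 0) (hy : form y delta = 0)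
    (h : rootCoeff x = rootCoeff y) : x = y := by
  rw [form_delta] at hx hy
  have h0 := congrFun h 0
  have h1 := congrFun h 1
  have h2 := congrFun h 2
  have h3 := congrFun h 3
  have h4 := congrFun h 4
  have h5 := congrFun h 5
  have h6 := congrFun h 6
  have h7 := congrFun h 7
  simp [rootCoeff] at h0 h1 h2 h3 h4 h5 h6 h7
  ext j
  fin_cases j <;> simp <;> linarith

/-- Real roots: integral classes of square `-2` orthogonal to `δ`. -/
structure IsRealRoot (r : V) : Prop where
  integral : IsIntegralClass r
  delta_eq : form r delta = 0
  self_eq : form r r = -2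

lemma isRealRoot_alpha (i : Fin 8) : IsRealRoot (α i) :=
  ⟨isIntegralClass_alpha i, form_alpha_delta i, form_alpha_self i⟩

lemma word_mem (l : List (Fin 8)) : word l ∈ W :=
  list_prod_mem fun _ hx => by
    obtain ⟨i, -, rfl⟩ := List.mem_map.1 hx
    exact sEquiv_mem i

lemma IsRealRoot.word {r : V} (hr : IsRealRoot r) (l : List (Fin 8)) : IsRealRoot (word l r) :=
  ⟨hr.integral.word l, (form_map_delta (word_mem l) r).trans hr.delta_eq,
    (form_word l r r).trans hr.self_eq⟩

/-- Half the negated form on the affine `E₇` root lattice, in simple root coordinates. -/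
def quadE (k : Fin 8 → ℤ) : ℤ :=
  k 0 ^ 2 + k 1 ^ 2 + k 2 ^ 2 + k 3 ^ 2 + k 4 ^ 2 + k 5 ^ 2 + k 6 ^ 2 + k 7 ^ 2
    - (k 1 * k 2 + k 2 * k 3 + k 3 * k 4 + k 4 * k 5 + k 5 * k 6 + k 6 * k 7 + k 0 * k 4)

lemma quadE_sum_sq (k : Fin 8 → ℤ) : 24 * quadE k =
    6 * (2 * k 1 - k 2) ^ 2 + 2 * (3 * k 2 - 2 * k 3) ^ 2 + (4 * k 3 - 3 * k 4) ^ 2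
    + 6 * (2 * k 7 - k 6) ^ 2 + 2 * (3 * k 6 - 2 * k 5) ^ 2 + (4 * k 5 - 3 * k 4) ^ 2
    + 6 * (2 * k 0 - k 4) ^ 2 := by
  unfold quadE; ring

lemma quadE_nonneg (k : Fin 8 → ℤ) : 0 ≤ quadE k := by
  have h := quadE_sum_sq k
  have : 0 ≤ 24 * quadE k := by rw [h]; positivity
  linarith

lemma pos_of_quadE_eq_zero {k : Fin 8 → ℤ} (h : quadE k = 0) {i : Fin 8} (hi : 0 < k i)
    (j : Fin 8) : 0 < k j := by
  have hs := quadE_sum_sq k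
  rw [h] at hs
  have s1 := sq_nonneg (2 * k 1 - k 2)
  have s2 := sq_nonneg (3 * k 2 - 2 * k 3)
  have s3 := sq_nonneg (4 * k 3 - 3 * k 4)
  have s4 := sq_nonneg (2 * k 7 - k 6)
  have s5 := sq_nonneg (3 * k 6 - 2 * k 5)
  have s6 := sq_nonneg (4 * k 5 - 3 * k 4)
  have s7 := sq_nonneg (2 * k 0 - k 4)
  have e1 : 2 * k 1 - k 2 = 0 := sq_eq_zero_iff.1 (by linarith)
  have e2 : 3 * k 2 - 2 * k 3 = 0 := sq_eq_zero_iff.1 (by linarith)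
  have e3 : 4 * k 3 - 3 * k 4 = 0 := sq_eq_zero_iff.1 (by linarith)
  have e4 : 2 * k 7 - k 6 = 0 := sq_eq_zero_iff.1 (by linarith)
  have e5 : 3 * k 6 - 2 * k 5 = 0 := sq_eq_zero_iff.1 (by linarith)
  have e6 : 4 * k 5 - 3 * k 4 = 0 := sq_eq_zero_iff.1 (by linarith)
  have e7 : 2 * k 0 - k 4 = 0 := sq_eq_zero_iff.1 (by linarith)
  have h4 : 0 < k 4 := by fin_cases i <;> simp at hi <;> omega
  fin_cases j <;> simp <;> omega

lemma quadE_sub_le (p n : Fin 8 → ℤ) (hp : ∀ i, 0 ≤ p i) (hn : ∀ i, 0 ≤ n i)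
    (hpn : ∀ i, p i * n i = 0) : quadE p + quadE n ≤ quadE (p - n) := by
  have h (i j : Fin 8) : 0 ≤ p i * n j := mul_nonneg (hp i) (hn j)
  have key : quadE (p - n) = quadE p + quadE n
      - 2 * (p 0 * n 0 + p 1 * n 1 + p 2 * n 2 + p 3 * n 3 + p 4 * n 4 + p 5 * n 5
        + p 6 * n 6 + p 7 * n 7)
      + (p 1 * n 2 + p 2 * n 3 + p 3 * n 4 + p 4 * n 5 + p 5 * n 6 + p 6 * n 7 + p 0 * n 4)
      + (p 2 * n 1 + p 3 * n 2 + p 4 * n 3 + p 5 * n 4 + p 6 * n 5 + p 7 * n 6 + p 4 * n 0) := by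
    simp only [quadE, Pi.sub_apply]; ring
  rw [key]
  simp only [hpn]
  linarith [h 1 2, h 2 3, h 3 4, h 4 5, h 5 6, h 6 7, h 0 4, h 2 1, h 3 2, h 4 3, h 5 4, h 6 5,
    h 7 6, h 4 0]

lemma nonneg_or_nonpos_of_quadE_eq_one {k : Fin 8 → ℤ} (hk : quadE k = 1) :
    (∀ i, 0 ≤ k i) ∨ ∀ i, k i ≤ 0 := by
  by_contra! hcon
  obtain ⟨⟨a, ha⟩, b, hb⟩ := hcon
  set p : Fin 8 → ℤ := fun i => max (k i) 0
  set n : Fin 8 → ℤ := fun i => max (-k i) 0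
  have hpn (i : Fin 8) : p i * n i = 0 := by
    rcases le_total (k i) 0 with h | h <;> simp [p, n, h]
  have hsub : p - n = k := by
    ext i; simp only [p, n, Pi.sub_apply]; omega
  have hle := quadE_sub_le p n (fun i => le_max_right _ _) (fun i => le_max_right _ _) hpn
  rw [hsub, hk] at hle
  have hpb : 0 < p b := lt_max_of_lt_left hb
  have hna : 0 < n a := lt_max_of_lt_left (neg_pos.2 ha)
  have hp0 := quadE_nonneg p
  have hn0 := quadE_nonneg n
  have hcase : quadE p = 0 ∨ quadE n = 0 := by omega
  rcases hcase with h | h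
  · exact (mul_pos (pos_of_quadE_eq_zero h hpb a) hna).ne' (hpn a)
  · exact (mul_pos hpb (pos_of_quadE_eq_zero h hna b)).ne' (hpn b)

lemma IsRealRoot.exists_rootCoeff {r : V} (hr : IsRealRoot r) :
    ∃ k : Fin 8 → ℤ, (∀ i, rootCoeff r i = k i) ∧ quadE k = 1 := by
  choose z hz using hr.integral
  have h1 := hr.delta_eq
  have h2 := hr.self_eq
  rw [form_delta] at h1
  rw [form_eq] at h2
  simp only [← hz, eq_intCast] at h1 h2
  norm_cast at h1
  replace h2 : 2 * z 0 * z 0 - (z 1 * z 1 + z 2 * z 2 + z 3 * z 3 + z 4 * z 4 + z 5 * z 5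
      + z 6 * z 6 + z 7 * z 7 + z 8 * z 8) = -2 := by exact_mod_cast h2
  refine ⟨![z 0, z 0 + z 1, 2 * z 0 + z 1 + z 2, 3 * z 0 + z 1 + z 2 + z 3,
    4 * z 0 + z 1 + z 2 + z 3 + z 4, 4 * z 0 + z 1 + z 2 + z 3 + z 4 + z 5,
    4 * z 0 + z 1 + z 2 + z 3 + z 4 + z 5 + z 6,
    4 * z 0 + z 1 + z 2 + z 3 + z 4 + z 5 + z 6 + z 7], fun i => ?_, ?_⟩
  · fin_cases i <;> simp [rootCoeff, ← hz]
  · have h8 : z 8 = -(4 * z 0 + z 1 + z 2 + z 3 + z 4 + z 5 + z 6 + z 7) := by linarith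
    rw [h8] at h2
    simp [quadE]
    linarith

lemma IsRealRoot.nonneg_or_nonpos {r : V} (hr : IsRealRoot r) :
    0 ≤ rootCoeff r ∨ rootCoeff r ≤ 0 := by
  obtain ⟨k, hk, hq⟩ := hr.exists_rootCoeff
  refine (nonneg_or_nonpos_of_quadE_eq_one hq).imp (fun h i => ?_) fun h i => ?_
  · rw [hk]; exact Int.cast_nonneg (h i)
  · rw [hk]; exact Int.cast_nonpos.2 (h i)

/-- A simple reflection makes only its own simple root negative. -/
lemma IsRealRoot.eq_alpha {r : V} (hr : IsRealRoot r) {j : Fin 8} (h0 : 0 ≤ rootCoeff r)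
    (h : rootCoeff (sEquiv j r) ≤ 0) : r = α j := by
  have hz (i : Fin 8) (hi : i ≠ j) : rootCoeff r i = 0 := by
    refine le_antisymm ?_ (h0 i)
    have := h i
    rwa [sEquiv_apply, rootCoeff_add, rootCoeff_smul, rootCoeff_alpha, Pi.add_apply,
      Pi.smul_apply, Pi.single_eq_of_ne hi, smul_zero, add_zero] at this
  have hrj : r = rootCoeff r j • α j := by
    refine eq_of_rootCoeff_eq hr.delta_eq
      (by rw [form_smul_left, form_alpha_delta, mul_zero]) ?_
    rw [rootCoeff_smul, rootCoeff_alpha]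
    ext i
    rcases eq_or_ne i j with rfl | hi
    · simp
    · simp [hz i hi, hi]
  have hself := hr.self_eq
  rw [hrj, form_smul_left, form_smul_right, form_alpha_self] at hself
  have h1 : rootCoeff r j = 1 := by
    have := h0 j
    simp only [Pi.zero_apply] at this
    nlinarith
  rw [hrj, h1, one_smul]

lemma mul_sEquiv_of_map_alpha {w : V ≃ₗ[ℝ] V} (hw : w ∈ W) {i j : Fin 8} (h : w (α i) = α j) :
    w * sEquiv i = sEquiv j * w := by
  ext1 x
  rw [LinearEquiv.mul_apply, LinearEquiv.mul_apply, sEquiv_apply, sEquiv_apply, map_add,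
    map_smul, ← h, form_map hw]

/-- The exchange condition. -/
lemma exists_word_mul_sEquiv (l : List (Fin 8)) (i : Fin 8)
    (h : rootCoeff (word l (α i)) ≤ 0) :
    ∃ l', l'.length < l.length ∧ word l * sEquiv i = word l' := by
  induction l with
  | nil =>
    have := h i
    change rootCoeff (α i) i ≤ 0 at this
    rw [rootCoeff_alpha, Pi.single_eq_same] at this
    linarith
  | cons j l ih =>
    rcases ((isRealRoot_alpha i).word l).nonneg_or_nonpos with hp | hn
    · have e := ((isRealRoot_alpha i).word l).eq_alpha (j := j) hp (by rwa [word_cons] at h)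
      refine ⟨l, by simp, ?_⟩
      rw [word_cons, mul_assoc, mul_sEquiv_of_map_alpha (word_mem l) e, ← mul_assoc,
        sEquiv_mul_self, one_mul]
    · obtain ⟨l', hl, e⟩ := ih hn
      exact ⟨j :: l', by simpa using hl, by rw [word_cons, word_cons, mul_assoc, e]⟩

lemma word_mul_sEquiv_apply (l : List (Fin 8)) (i : Fin 8) (x : V) :
    word l (sEquiv i x) = word l x + form (α i) x • word l (α i) := by
  rw [sEquiv_apply, map_add, map_smul]

/-- A dominant class is the smallest element of its orbit. -/
lemma rootCoeff_le_word {x : V} (hx : x ∈ Cbar) (l : List (Fin 8)) :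
    rootCoeff x ≤ rootCoeff (word l x) := by
  induction hn : l.length using Nat.strong_induction_on generalizing l with
  | _ n ih =>
    subst hn
    by_cases hneg : ∃ i, rootCoeff (word l (α i)) ≤ 0
    · obtain ⟨i, hi⟩ := hneg
      obtain ⟨l', hl, e⟩ := exists_word_mul_sEquiv l i hi
      have e' (y : V) : word l y = word l' (sEquiv i y) := by
        rw [← LinearEquiv.mul_apply, ← e, mul_assoc, sEquiv_mul_self, mul_one]
      have hpos : 0 ≤ rootCoeff (word l' (α i)) := by
        have := e' (α i)
        rw [sEquiv_alpha, map_neg] at this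
        rw [this, rootCoeff_neg] at hi
        simpa using hi
      rw [e', word_mul_sEquiv_apply, rootCoeff_add, rootCoeff_smul]
      have hc : 0 ≤ form (α i) x := form_comm x _ ▸ hx i
      exact (ih _ hl l' rfl).trans (le_add_of_nonneg_right (smul_nonneg hc hpos))
    · rcases List.eq_nil_or_concat l with rfl | ⟨l₁, j, rfl⟩
      · exact le_rfl
      · rw [List.concat_eq_append] at *
        have hj : rootCoeff (word l₁ (α j)) ≤ 0 := by
          have h1 := ((isRealRoot_alpha j).word (l₁ ++ [j])).nonneg_or_nonpos.resolve_right
            fun h => hneg ⟨j, h⟩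
          rw [word_append, word_singleton, LinearEquiv.mul_apply, sEquiv_alpha, map_neg,
            rootCoeff_neg] at h1
          simpa using h1
        obtain ⟨l', hl, e⟩ := exists_word_mul_sEquiv l₁ j hj
        rw [word_append, word_singleton, e]
        exact ih _ (by simp; omega) _ rfl

/-! ### Dominant classes in `B` -/

lemma sEquiv_apply_zero (i : Fin 8) (hi : i ≠ 0) (x : V) : sEquiv i x 0 = x 0 := by
  fin_cases i <;> first | exact absurd rfl hi | simp +decide [sEquiv_apply, α, Ev]

lemma sEquiv_apply_castSucc (i : Fin 8) (hi : i ≠ 0) (x : V) :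
    sEquiv i x i.castSucc = x i.succ := by
  rw [sEquiv_apply, form_comm, form_alpha_of_ne x i hi]
  fin_cases i <;> first | exact absurd rfl hi | simp +decide [α, Ev]

lemma sEquiv_apply_succ (i : Fin 8) (hi : i ≠ 0) (x : V) :
    sEquiv i x i.succ = x i.castSucc := by
  rw [sEquiv_apply, form_comm, form_alpha_of_ne x i hi]
  fin_cases i <;> first | exact absurd rfl hi | simp +decide [α, Ev]

lemma map_mem_Bset {x : V} (hC : x ∈ Cbar) (hB : x ∈ Bset) {w : V ≃ₗ[ℝ] V} (hw : w ∈ W) :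
    w x ∈ Bset := by
  rw [mem_Bset_iff] at hB
  have hle {w : V ≃ₗ[ℝ] V} (hw : w ∈ W) : rootCoeff x ≤ rootCoeff (w x) := by
    obtain ⟨l, rfl⟩ := exists_word hw
    exact rootCoeff_le_word hC l
  have hlast (w : V ≃ₗ[ℝ] V) (hw : w ∈ W) : w x 8 ≤ 0 := by
    have h7 := hle hw 7
    have hd := form_map_delta hw x
    have h8 : x 8 ≤ 0 := (hB 7).1
    rw [form_delta, form_delta] at hd
    simp [rootCoeff] at h7
    linarith
  have hfirst (w : V ≃ₗ[ℝ] V) (hw : w ∈ W) : 0 ≤ w x 0 + w x 1 := by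
    have h1 := hle hw 1
    have h0 : 0 ≤ x 0 + x 1 := (hB 0).2
    simp [rootCoeff] at h1
    linarith
  have hnonpos (i : Fin 8) : ∀ w ∈ W, w x i.succ ≤ 0 := by
    induction i using Fin.reverseInduction with
    | last => exact hlast
    | cast j ih =>
      intro w hw
      have h := ih _ (mul_mem (sEquiv_mem j.succ) hw)
      rwa [LinearEquiv.mul_apply, sEquiv_apply_succ _ (Fin.succ_ne_zero j),
        ← Fin.succ_castSucc] at h
  have hnonneg (i : Fin 8) : ∀ w ∈ W, 0 ≤ w x 0 + w x i.succ := by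
    induction i using Fin.induction with
    | zero => exact hfirst
    | succ j ih =>
      intro w hw
      have h := ih _ (mul_mem (sEquiv_mem j.succ) hw)
      rwa [LinearEquiv.mul_apply, sEquiv_apply_zero _ (Fin.succ_ne_zero j), Fin.succ_castSucc,
        sEquiv_apply_castSucc _ (Fin.succ_ne_zero j)] at h
  exact (mem_Bset_iff _).2 fun i => ⟨hnonpos i w hw, hnonneg i w hw⟩

/-! ### The Tits cone -/

lemma sum_sq_add_half (v : V) :
    ∑ i : Fin 8, (v i.succ + v 0 / 2) ^ 2 = v 0 * form v delta - form v v := by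
  rw [form_delta, form_eq]
  simp only [Fin.sum_univ_eight, Fin.reduceSucc]
  ring

lemma finite_isIntegralClass_of_abs_le (R : ℝ) :
    {y : V | IsIntegralClass y ∧ ∀ j, |y j| ≤ R}.Finite := by
  refine ((Set.finite_Icc (fun _ : Fin 9 => -⌈R⌉) fun _ => ⌈R⌉).image
    fun z j => (z j : ℝ)).subset ?_
  rintro y ⟨hy, hR⟩
  choose z hz using hy
  have hz' (j : Fin 9) : (z j : ℝ) = y j := hz j
  have hb (j : Fin 9) : |(z j : ℝ)| ≤ (⌈R⌉ : ℝ) := by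
    rw [hz']; exact (hR j).trans (Int.le_ceil R)
  refine ⟨z, ⟨fun j => ?_, fun j => ?_⟩, funext hz'⟩
  · exact_mod_cast (abs_le.1 (hb j)).1
  · exact_mod_cast (abs_le.1 (hb j)).2

/-- Integral classes of fixed square and fixed positive degree against `δ` lie on a paraboloid,
on which pairing with a class positive against `δ` is proper. -/
lemma finite_isIntegralClass_of_form_le {x : V} (hx : 0 < form x delta) (N M : ℝ) {c : ℝ}
    (hc : 0 < c) :
    {y : V | IsIntegralClass y ∧ form y y = N ∧ form y delta = c ∧ form x y ≤ M}.Finite := by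
  set t := c / form x delta with ht
  have ht0 : 0 < t := div_pos hc hx
  set R := 2 * t * M - N - t ^ 2 * form x x
  set G := |R| + 1 + t * ∑ i : Fin 8, |x i.succ + x 0 / 2|
  set D := (|N| + 8 * G ^ 2) / c
  have hG0 : 0 ≤ G := by positivity
  have hD0 : 0 ≤ D := by positivity
  refine (finite_isIntegralClass_of_abs_le (G + D)).subset ?_
  rintro y ⟨hint, hN, hyc, hM⟩
  refine ⟨hint, ?_⟩
  have hz : ∑ i : Fin 8, ((y + (-t) • x) i.succ + (y + (-t) • x) 0 / 2) ^ 2 ≤ R := by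
    have h0 : form (y + (-t) • x) delta = 0 := by
      rw [form_add_left, form_smul_left, hyc, ht]
      field_simp
      ring
    rw [sum_sq_add_half, h0, form_add_left, form_add_right, form_add_right, form_smul_left,
      form_smul_left, form_smul_right, form_smul_right, hN, form_comm y x]
    nlinarith
  have hg (i : Fin 8) : |y i.succ + y 0 / 2| ≤ G := by
    have h1 : ((y + (-t) • x) i.succ + (y + (-t) • x) 0 / 2) ^ 2 ≤ R :=
      (Finset.single_le_sum (f := fun i : Fin 8 =>
        ((y + (-t) • x) i.succ + (y + (-t) • x) 0 / 2) ^ 2)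
        (fun _ _ => sq_nonneg _) (Finset.mem_univ i)).trans hz
    have h2 : |(y + (-t) • x) i.succ + (y + (-t) • x) 0 / 2| ≤ |R| + 1 := by
      refine abs_le_of_sq_le_sq (h1.trans ?_) (by positivity)
      nlinarith [le_abs_self R, abs_nonneg R]
    have h3 : |x i.succ + x 0 / 2| ≤ ∑ i : Fin 8, |x i.succ + x 0 / 2| :=
      Finset.single_le_sum (f := fun i : Fin 8 => |x i.succ + x 0 / 2|)
        (fun _ _ => abs_nonneg _) (Finset.mem_univ i)
    have h4 : y i.succ + y 0 / 2 =
        ((y + (-t) • x) i.succ + (y + (-t) • x) 0 / 2) + t * (x i.succ + x 0 / 2) := by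
      simp only [Pi.add_apply, Pi.smul_apply, smul_eq_mul]; ring
    rw [h4]
    refine (abs_add_le _ _).trans (add_le_add h2 ?_)
    rw [abs_mul, abs_of_pos ht0]
    exact mul_le_mul_of_nonneg_left h3 ht0.le
  have hd : |y 0| ≤ D := by
    have h1 := sum_sq_add_half y
    rw [hyc, hN] at h1
    have h2 : ∑ i : Fin 8, (y i.succ + y 0 / 2) ^ 2 ≤ ∑ _i : Fin 8, G ^ 2 :=
      Finset.sum_le_sum fun i _ => sq_le_sq' (abs_le.1 (hg i)).1 (abs_le.1 (hg i)).2
    have h3 : 0 ≤ ∑ i : Fin 8, (y i.succ + y 0 / 2) ^ 2 :=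
      Finset.sum_nonneg fun _ _ => sq_nonneg _
    simp only [Finset.sum_const, Finset.card_univ, Fintype.card_fin, nsmul_eq_mul] at h2
    push_cast at h2
    have h4 : |y 0| * c = |y 0 * c| := by rw [abs_mul, abs_of_pos hc]
    rw [le_div_iff₀ hc, h4, abs_le]
    constructor <;> linarith [le_abs_self N, neg_abs_le N]
  intro j
  refine Fin.cases (hd.trans (le_add_of_nonneg_left hG0)) (fun i => ?_) j
  have h1 := abs_le.1 (hg i)
  have h2 := abs_le.1 hd
  rw [abs_le]
  constructor <;> linarith

/-- An integral class in the interior of the fundamental chamber. -/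
def rho : V := ![12, -7, -6, -5, -4, -3, -2, -1, 0]

lemma form_rho_alpha_pos (i : Fin 8) : 0 < form rho (α i) := by
  rcases eq_or_ne i 0 with rfl | hi
  · rw [form_alpha_zero]; simp [rho]; norm_num
  · rw [form_alpha_of_ne _ _ hi]
    fin_cases i <;> first | exact absurd rfl hi | (simp [rho]; try norm_num)

lemma isIntegralClass_rho : IsIntegralClass rho := fun j =>
  ⟨(![12, -7, -6, -5, -4, -3, -2, -1, 0] : Fin 9 → ℤ) j, by fin_cases j <;> simp [rho]⟩

lemma exists_map_mem_Cbar {x : V} (hx : 0 < form x delta) : ∃ w ∈ W, w x ∈ Cbar := by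
  set S : Set V := {y | ∃ w ∈ W, w rho = y ∧ form x y ≤ form x rho}
  have hc : 0 < form rho delta := by rw [form_delta]; simp [rho]; norm_num
  have hS : S.Finite := by
    refine (finite_isIntegralClass_of_form_le hx (form rho rho) (form x rho) hc).subset ?_
    rintro _ ⟨w, hw, rfl, hle⟩
    refine ⟨?_, form_map hw _ _, form_map_delta hw _, hle⟩
    obtain ⟨l, rfl⟩ := exists_word hw
    exact isIntegralClass_rho.word l
  obtain ⟨_, ⟨w, hw, rfl, hle⟩, hmin⟩ :=
    Set.exists_min_image S (form x) hS ⟨rho, 1, one_mem W, rfl, le_rfl⟩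
  refine ⟨w⁻¹, inv_mem hw, fun i => ?_⟩
  by_contra! hneg
  have hpair : form x (w (α i)) = form (w⁻¹ x) (α i) := by
    rw [← form_map hw (w⁻¹ x), ← LinearEquiv.mul_apply, mul_inv_cancel]; rfl
  have hlt : form x (w (sEquiv i rho)) < form x (w rho) := by
    rw [sEquiv_apply, map_add, map_smul, form_add_right, form_smul_right, hpair, form_comm (α i)]
    linarith [mul_neg_of_pos_of_neg (form_rho_alpha_pos i) hneg]
  exact (hmin _ ⟨w * sEquiv i, mul_mem hw (sEquiv_mem i), rfl, hlt.le.trans hle⟩).not_gt hlt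

lemma form_delta_nonneg {x : V} (hx : x ∈ Cbar) : 0 ≤ form x delta := by
  obtain ⟨h0, h1, h2, h3, h4, h5, h6, h7⟩ := (mem_Cbar_iff x).1 hx
  rw [form_delta]; linarith

lemma eq_smul_delta {x : V} (hx : x ∈ Cbar) (h : form x delta = 0) :
    x = (x 0 / 2) • delta := by
  obtain ⟨h0, h1, h2, h3, h4, h5, h6, h7⟩ := (mem_Cbar_iff x).1 hx
  rw [form_delta] at h
  ext j
  fin_cases j <;> simp +decide [delta, Hv, Ev, Fin.sum_univ_eight] <;> linarith

/-- The Tits cone. -/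
def tits : Set V := ⋃ w ∈ W, (w : V ≃ₗ[ℝ] V) '' Cbar

lemma mem_tits_iff {x : V} : x ∈ tits ↔ ∃ w ∈ W, w x ∈ Cbar := by
  simp only [tits, Set.mem_iUnion, exists_prop]
  constructor
  · rintro ⟨w, hw, c, hc, rfl⟩
    refine ⟨w⁻¹, inv_mem hw, ?_⟩
    rwa [← LinearEquiv.mul_apply, inv_mul_cancel]
  · rintro ⟨w, hw, h⟩
    refine ⟨w⁻¹, inv_mem hw, w x, h, ?_⟩
    rw [← LinearEquiv.mul_apply, inv_mul_cancel]; rfl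

lemma mem_tits_iff' {x : V} :
    x ∈ tits ↔ 0 < form x delta ∨ ∃ t : ℝ, x = t • delta := by
  rw [mem_tits_iff]
  constructor
  · rintro ⟨w, hw, h⟩
    rcases (form_delta_nonneg h).eq_or_lt' with h0 | h0
    · refine Or.inr ⟨w x 0 / 2, w.injective ?_⟩
      rw [map_smul, map_delta hw]
      exact eq_smul_delta h h0
    · exact Or.inl (form_map_delta hw x ▸ h0)
  · rintro (h | ⟨t, rfl⟩)
    · exact exists_map_mem_Cbar h
    · exact ⟨1, one_mem W, delta_mem_Cbar t⟩

lemma form_smul_delta_delta (t : ℝ) : form (t • delta) delta = 0 := by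
  rw [form_smul_left, form_delta]
  simp +decide [delta, Hv, Ev, Fin.sum_univ_eight]
  norm_num

lemma add_mem_tits {x y : V} (hx : x ∈ tits) (hy : y ∈ tits) : x + y ∈ tits := by
  rw [mem_tits_iff'] at *
  rw [form_add_left]
  rcases hx with hx | ⟨t, rfl⟩ <;> rcases hy with hy | ⟨s, rfl⟩
  · exact Or.inl (add_pos hx hy)
  · exact Or.inl (by rwa [form_smul_delta_delta, add_zero])
  · exact Or.inl (by rwa [form_smul_delta_delta, zero_add])
  · exact Or.inr ⟨t + s, (add_smul t s delta).symm⟩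

lemma smul_mem_tits {c : ℝ} (hc : 0 ≤ c) {x : V} (hx : x ∈ tits) : c • x ∈ tits := by
  obtain ⟨w, hw, h⟩ := mem_tits_iff.1 hx
  refine mem_tits_iff.2 ⟨w, hw, fun i => ?_⟩
  rw [map_smul, form_smul_left]
  exact mul_nonneg hc (h i)

/-- The intersection of the Tits cone with all translates of `B`. -/
def titsB : Set V := tits ∩ ⋂ w ∈ W, (w : V ≃ₗ[ℝ] V) ⁻¹' Bset

lemma mem_titsB_iff {x : V} : x ∈ titsB ↔ x ∈ tits ∧ ∀ w ∈ W, w x ∈ Bset := by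
  simp [titsB]

lemma add_mem_titsB {x y : V} (hx : x ∈ titsB) (hy : y ∈ titsB) : x + y ∈ titsB := by
  rw [mem_titsB_iff] at *
  refine ⟨add_mem_tits hx.1 hy.1, fun w hw => ?_⟩
  have h1 := (mem_Bset_iff _).1 (hx.2 w hw)
  have h2 := (mem_Bset_iff _).1 (hy.2 w hw)
  rw [mem_Bset_iff, map_add]
  intro i
  simp only [Pi.add_apply]
  constructor <;> linarith [(h1 i).1, (h1 i).2, (h2 i).1, (h2 i).2]

lemma smul_mem_titsB {c : ℝ} (hc : 0 ≤ c) {x : V} (hx : x ∈ titsB) : c • x ∈ titsB := by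
  rw [mem_titsB_iff] at *
  refine ⟨smul_mem_tits hc hx.1, fun w hw => ?_⟩
  have h := (mem_Bset_iff _).1 (hx.2 w hw)
  rw [mem_Bset_iff, map_smul]
  intro i
  simp only [Pi.smul_apply, smul_eq_mul]
  exact ⟨mul_nonpos_of_nonneg_of_nonpos hc (h i).1,
    by rw [← mul_add]; exact mul_nonneg hc (h i).2⟩

lemma map_mem_titsB {w : V ≃ₗ[ℝ] V} (hw : w ∈ W) {x : V} (hx : x ∈ titsB) : w x ∈ titsB := by
  rw [mem_titsB_iff, mem_tits_iff] at *
  obtain ⟨⟨v, hv, hC⟩, hB⟩ := hx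
  refine ⟨⟨v * w⁻¹, mul_mem hv (inv_mem hw), ?_⟩, fun u hu => hB _ (mul_mem hu hw)⟩
  rwa [← LinearEquiv.mul_apply, mul_assoc, inv_mul_cancel, mul_one]

lemma mem_titsB_of_mem {x : V} (hC : x ∈ Cbar) (hB : x ∈ Bset) : x ∈ titsB :=
  mem_titsB_iff.2 ⟨mem_tits_iff.2 ⟨1, one_mem W, hC⟩, fun _ hw => map_mem_Bset hC hB hw⟩

/-! ### The cone `Π` -/

lemma inCone_smul {S : Set V} {c : ℝ} (hc : 0 ≤ c) {x : V} (hx : inCone S x) :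
    inCone S (c • x) := by
  obtain ⟨n, a, g, ha, hg, rfl⟩ := hx
  exact ⟨n, fun i => c * a i, g, fun i => mul_nonneg hc (ha i), hg, by
    simp only [Finset.smul_sum, mul_smul]⟩

lemma inCone_add {S : Set V} {x y : V} (hx : inCone S x) (hy : inCone S y) :
    inCone S (x + y) := by
  obtain ⟨n, a, g, ha, hg, rfl⟩ := hx
  obtain ⟨m, b, f, hb, hf, rfl⟩ := hy
  refine ⟨n + m, Fin.append a b, Fin.append g f, fun i => ?_, fun i => ?_, ?_⟩
  · refine Fin.addCases (fun i => ?_) (fun i => ?_) i <;> simp [ha, hb]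
  · refine Fin.addCases (fun i => ?_) (fun i => ?_) i <;> simp [hg, hf]
  · simp [Fin.sum_univ_add]

lemma inCone_of_mem {S : Set V} {x : V} (hx : x ∈ S) : inCone S x :=
  ⟨1, fun _ => 1, fun _ => x, fun _ => zero_le_one, fun _ => hx, by simp⟩

/-- The generators `L_k = 2H - E_1 - ⋯ - E_k` of `Π`. -/
def genL (k : ℕ) : V :=
  (2 : ℝ) • Hv - ∑ i ∈ Finset.univ.filter (fun i : Fin 8 => i.1 < k), Ev i

/-- The generators `M_l = 3H - 3E_1 - E_2 - ⋯ - E_l` of `Π`. -/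
def genM (l : ℕ) : V :=
  (3 : ℝ) • Hv - (3 : ℝ) • Ev 0
    - ∑ i ∈ Finset.univ.filter (fun i : Fin 8 => 1 ≤ i.1 ∧ i.1 < l), Ev i

lemma sum_Ev_zero (s : Finset (Fin 8)) : (∑ i ∈ s, Ev i) 0 = 0 := by
  rw [Finset.sum_apply]
  exact Finset.sum_eq_zero fun i _ => if_neg (Fin.succ_ne_zero i).symm

lemma sum_Ev_succ (s : Finset (Fin 8)) (j : Fin 8) :
    (∑ i ∈ s, Ev i) j.succ = if j ∈ s then 1 else 0 := by
  simp [Finset.sum_apply, Ev]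

lemma genL_zero (k : ℕ) : genL k 0 = 2 := by
  simp [genL, Hv, sum_Ev_zero, -Finset.sum_apply]

lemma genL_succ (k : ℕ) (i : Fin 8) : genL k i.succ = if i.1 < k then -1 else 0 := by
  simp only [genL, Pi.sub_apply, sum_Ev_succ]
  by_cases h : i.1 < k <;> simp [Hv, h]

lemma genM_zero (l : ℕ) : genM l 0 = 3 := by
  simp [genM, Hv, Ev, sum_Ev_zero, -Finset.sum_apply]

lemma genM_succ (l : ℕ) (i : Fin 8) :
    genM l i.succ = if i = 0 then -3 else if i.1 < l then -1 else 0 := by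
  simp only [genM, Pi.sub_apply, sum_Ev_succ]
  rcases eq_or_ne i 0 with rfl | hi
  · simp [Hv, Ev]
  · have h1 : 1 ≤ i.1 := Nat.one_le_iff_ne_zero.2 fun h => hi (Fin.ext h)
    have h2 : i.succ ≠ 1 := fun h => hi (Fin.succ_injective _ h)
    by_cases h : i.1 < l <;> simp [Hv, Ev, hi, h, h1, h2]

lemma Hv_mem : Hv ∈ PiGens := by simp [PiGens]

lemma Hv_sub_mem (i : Fin 8) (hi : i.1 < 3) : Hv - Ev i ∈ PiGens :=
  Or.inl (Or.inl (Or.inl (Or.inr ⟨i, hi, rfl⟩)))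

lemma Hv_sub_sub_mem (i j : Fin 8) (hij : i < j) (hj : j.1 < 3) : Hv - Ev i - Ev j ∈ PiGens :=
  Or.inl (Or.inl (Or.inr ⟨i, j, hij, hj, rfl⟩))

lemma genL_mem (k : ℕ) (h4 : 4 ≤ k) (h8 : k ≤ 8) : genL k ∈ PiGens :=
  Or.inl (Or.inr ⟨k, h4, h8, rfl⟩)

lemma genM_mem (l : ℕ) (h4 : 4 ≤ l) (h8 : l ≤ 8) : genM l ∈ PiGens :=
  Or.inr ⟨l, h4, h8, rfl⟩

lemma mem_titsB_of_coords {x : V} (h0 : 0 ≤ 2 * x 0 + x 1 + x 2 + x 3 + x 4)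
    (h1 : x 1 ≤ x 2) (h2 : x 2 ≤ x 3) (h3 : x 3 ≤ x 4) (h4 : x 4 ≤ x 5) (h5 : x 5 ≤ x 6)
    (h6 : x 6 ≤ x 7) (h7 : x 7 ≤ x 8) (h8 : x 8 ≤ 0) (hd : 0 ≤ x 0 + x 1) : x ∈ titsB := by
  refine mem_titsB_of_mem ((mem_Cbar_iff x).2 ⟨h0, h1, h2, h3, h4, h5, h6, h7⟩)
    ((mem_Bset_iff x).2 fun i => ?_)
  fin_cases i <;> simp <;> constructor <;> linarith

lemma Hv_mem_titsB : Hv ∈ titsB := by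
  apply mem_titsB_of_coords <;> simp +decide [Hv]

lemma Hv_sub_Ev_zero_mem_titsB : Hv - Ev 0 ∈ titsB := by
  apply mem_titsB_of_coords <;> simp +decide [Hv, Ev]

lemma Hv_sub_Ev_zero_sub_Ev_one_mem_titsB : Hv - Ev 0 - Ev 1 ∈ titsB := by
  apply mem_titsB_of_coords <;> (simp +decide [Hv, Ev]; try norm_num)

lemma genL_mem_titsB (k : ℕ) (h4 : 4 ≤ k) (h8 : k ≤ 8) : genL k ∈ titsB := by
  have h1 : genL k 1 = -1 := (genL_succ k 0).trans (if_pos (show 0 < k by omega))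
  have h2 : genL k 2 = -1 := (genL_succ k 1).trans (if_pos (show 1 < k by omega))
  have h3 : genL k 3 = -1 := (genL_succ k 2).trans (if_pos (show 2 < k by omega))
  have h4' : genL k 4 = -1 := (genL_succ k 3).trans (if_pos (show 3 < k by omega))
  have h5 : genL k 5 = if 4 < k then -1 else 0 := genL_succ k 4
  have h6 : genL k 6 = if 5 < k then -1 else 0 := genL_succ k 5
  have h7 : genL k 7 = if 6 < k then -1 else 0 := genL_succ k 6
  have h8' : genL k 8 = if 7 < k then -1 else 0 := genL_succ k 7
  apply mem_titsB_of_coords <;>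
    simp only [genL_zero, h1, h2, h3, h4', h5, h6, h7, h8'] <;>
    (try split_ifs) <;> first | omega | norm_num

lemma genM_mem_titsB (l : ℕ) (h4 : 4 ≤ l) (h8 : l ≤ 8) : genM l ∈ titsB := by
  have h1 : genM l 1 = -3 := genM_succ l 0
  have h2 : genM l 2 = -1 := (genM_succ l 1).trans (if_pos (show 1 < l by omega))
  have h3 : genM l 3 = -1 := (genM_succ l 2).trans (if_pos (show 2 < l by omega))
  have h4' : genM l 4 = -1 := (genM_succ l 3).trans (if_pos (show 3 < l by omega))
  have h5 : genM l 5 = if 4 < l then -1 else 0 := genM_succ l 4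
  have h6 : genM l 6 = if 5 < l then -1 else 0 := genM_succ l 5
  have h7 : genM l 7 = if 6 < l then -1 else 0 := genM_succ l 6
  have h8' : genM l 8 = if 7 < l then -1 else 0 := genM_succ l 7
  apply mem_titsB_of_coords <;>
    simp only [genM_zero, h1, h2, h3, h4', h5, h6, h7, h8'] <;>
    (try split_ifs) <;> first | omega | norm_num

lemma sEquiv_Hv (i : Fin 8) (hi : i ≠ 0) : sEquiv i Hv = Hv := by
  rw [sEquiv_apply, form_comm, form_alpha_of_ne _ _ hi]
  fin_cases i <;> first | exact absurd rfl hi | simp +decide [Hv]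

lemma sEquiv_Ev (i j : Fin 8) (hi : i ≠ 0) :
    sEquiv i (Ev j) = Ev (Equiv.swap (i - 1) i j) := by
  rw [sEquiv_apply, form_comm, form_alpha_of_ne _ _ hi]
  fin_cases i <;> first
    | exact absurd rfl hi
    | (ext k; fin_cases j <;> fin_cases k <;> simp +decide [Ev, α])

lemma Hv_sub_Ev_mem_titsB (i : Fin 8) (hi : i.1 < 3) : Hv - Ev i ∈ titsB := by
  have h0 := Hv_sub_Ev_zero_mem_titsB
  have h1 := map_mem_titsB (sEquiv_mem 1) h0
  rw [map_sub, sEquiv_Hv 1 (by decide), sEquiv_Ev 1 0 (by decide)] at h1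
  have h2 := map_mem_titsB (sEquiv_mem 2) h1
  rw [map_sub, sEquiv_Hv 2 (by decide), sEquiv_Ev 2 _ (by decide)] at h2
  obtain ⟨i, hi8⟩ := i
  simp only at hi
  interval_cases i
  exacts [h0, h1, h2]

lemma Hv_sub_Ev_sub_Ev_mem_titsB (i j : Fin 8) (hij : i < j) (hj : j.1 < 3) :
    Hv - Ev i - Ev j ∈ titsB := by
  have h0 := Hv_sub_Ev_zero_sub_Ev_one_mem_titsB
  have h1 := map_mem_titsB (sEquiv_mem 2) h0
  rw [map_sub, map_sub, sEquiv_Hv 2 (by decide), sEquiv_Ev 2 0 (by decide),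
    sEquiv_Ev 2 1 (by decide)] at h1
  have h2 := map_mem_titsB (sEquiv_mem 1) h1
  rw [map_sub, map_sub, sEquiv_Hv 1 (by decide), sEquiv_Ev 1 _ (by decide),
    sEquiv_Ev 1 _ (by decide)] at h2
  obtain ⟨i, hi8⟩ := i
  obtain ⟨j, hj8⟩ := j
  simp only [Fin.mk_lt_mk] at hij hj
  interval_cases j <;> interval_cases i
  exacts [h0, h1, h2]

lemma PiGens_subset_titsB : PiGens ⊆ titsB := by
  rintro x ((((rfl | ⟨i, hi, rfl⟩) | ⟨i, j, hij, hj, rfl⟩) | ⟨k, h4, h8, rfl⟩) |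
    ⟨l, h4, h8, rfl⟩)
  · exact Hv_mem_titsB
  · exact Hv_sub_Ev_mem_titsB i hi
  · exact Hv_sub_Ev_sub_Ev_mem_titsB i j hij hj
  · exact genL_mem_titsB k h4 h8
  · exact genM_mem_titsB l h4 h8

lemma PiCone_subset_titsB : PiCone ⊆ titsB := by
  rintro _ ⟨n, c, g, hc, hg, rfl⟩
  have h0 : (0 : V) ∈ titsB := by
    simpa using smul_mem_titsB le_rfl Hv_mem_titsB
  exact Finset.sum_induction _ (· ∈ titsB) (fun _ _ => add_mem_titsB) h0
    fun i _ => smul_mem_titsB (hc i) (PiGens_subset_titsB (hg i))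

lemma Cbar_inter_Bset_subset_PiCone : Cbar ∩ Bset ⊆ PiCone := by
  rintro x ⟨hC, hB⟩
  obtain ⟨h0, h1, h2, h3, h4, h5, h6, h7⟩ := (mem_Cbar_iff x).1 hC
  have h8 : x 8 ≤ 0 := ((mem_Bset_iff x).1 hB 7).1
  have hd : 0 ≤ x 0 + x 1 := ((mem_Bset_iff x).1 hB 0).2
  set a := x 0 + (x 1 + x 2 + x 3 + x 4) / 2 with ha
  set b := (x 2 - x 1) / 2 with hb
  set c := (x 4 - x 3) / 2 with hc
  set S := a + c - x 4 with hS
  have hbS : b ≤ S := by linarith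
  have ha0 : 0 ≤ a := by linarith
  have hb0 : 0 ≤ b := by linarith
  have hc0 : 0 ≤ c := by linarith
  obtain ⟨t, ht0, ht1, htS⟩ : ∃ t : ℝ, 0 ≤ t ∧ 0 ≤ 1 - t ∧ t * S = b := by
    rcases (hb0.trans hbS).eq_or_lt with h | h
    · exact ⟨0, le_rfl, by norm_num, by linarith⟩
    · exact ⟨b / S, div_nonneg hb0 h.le, sub_nonneg.2 (div_le_one_of_le₀ hbS h.le),
        div_mul_cancel₀ b h.ne'⟩
  have hx : x = ((1 - t) * a) • Hv + (t * a * 2) • (Hv - Ev 0) + (x 3 - x 2) • (Hv - Ev 0 - Ev 1)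
      + ((1 - t) * c) • (Hv - Ev 0 - Ev 1)
      + ((1 - t) * c) • (Hv - Ev 0 - Ev 2) + ((1 - t) * c) • (Hv - Ev 1 - Ev 2)
      + (t * c * 2) • (Hv - Ev 0 - Ev 1) + (t * c * 2) • (Hv - Ev 0 - Ev 2)
      + ((1 - t) * (x 5 - x 4)) • genL 4 + (t * (x 5 - x 4)) • genM 4
      + ((1 - t) * (x 6 - x 5)) • genL 5 + (t * (x 6 - x 5)) • genM 5
      + ((1 - t) * (x 7 - x 6)) • genL 6 + (t * (x 7 - x 6)) • genM 6
      + ((1 - t) * (x 8 - x 7)) • genL 7 + (t * (x 8 - x 7)) • genM 7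
      + ((1 - t) * (-x 8)) • genL 8 + (t * (-x 8)) • genM 8 := by
    ext j
    simp only [Pi.add_apply, Pi.sub_apply, Pi.smul_apply, smul_eq_mul]
    refine Fin.cases ?_ (fun i => ?_) j
    · simp +decide only [genL_zero, genM_zero, Hv, Ev, if_true, if_false]
      linear_combination -htS
    · simp only [genL_succ, genM_succ]
      fin_cases i <;> simp +decide [Hv, Ev] <;>
        first | ring1 | linear_combination 2 * htS
  have g {y : V} (hy : y ∈ PiGens) {s : ℝ} (hs : 0 ≤ s) : inCone PiGens (s • y) :=
    inCone_smul hs (inCone_of_mem hy)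
  have gL (k : ℕ) (k4 : 4 ≤ k) (k8 : k ≤ 8) {s : ℝ} (hs : 0 ≤ s) :
      inCone PiGens (((1 - t) * s) • genL k) := g (genL_mem k k4 k8) (mul_nonneg ht1 hs)
  have gM (k : ℕ) (k4 : 4 ≤ k) (k8 : k ≤ 8) {s : ℝ} (hs : 0 ≤ s) :
      inCone PiGens ((t * s) • genM k) := g (genM_mem k k4 k8) (mul_nonneg ht0 hs)
  have e01 := Hv_sub_sub_mem 0 1 (by decide) (by decide)
  have e02 := Hv_sub_sub_mem 0 2 (by decide) (by decide)
  have e12 := Hv_sub_sub_mem 1 2 (by decide) (by decide)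
  show inCone PiGens x
  rw [hx]
  have k5 : 0 ≤ x 5 - x 4 := sub_nonneg.2 h4
  have k6 : 0 ≤ x 6 - x 5 := sub_nonneg.2 h5
  have k7 : 0 ≤ x 7 - x 6 := sub_nonneg.2 h6
  have k8 : 0 ≤ x 8 - x 7 := sub_nonneg.2 h7
  have k9 : 0 ≤ -x 8 := neg_nonneg.2 h8
  refine inCone_add (inCone_add (inCone_add (inCone_add (inCone_add (inCone_add (inCone_add
    (inCone_add (inCone_add (inCone_add (inCone_add (inCone_add (inCone_add (inCone_add
    (inCone_add (inCone_add (inCone_add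
    (g Hv_mem (mul_nonneg ht1 ha0)) (g (Hv_sub_mem 0 (by decide)) (by positivity)))
    (g e01 (sub_nonneg.2 h2))) (g e01 (mul_nonneg ht1 hc0))) (g e02 (mul_nonneg ht1 hc0)))
    (g e12 (mul_nonneg ht1 hc0))) (g e01 (by positivity))) (g e02 (by positivity)))
    (gL 4 ?_ ?_ k5)) (gM 4 ?_ ?_ k5)) (gL 5 ?_ ?_ k6)) (gM 5 ?_ ?_ k6)) (gL 6 ?_ ?_ k7))
    (gM 6 ?_ ?_ k7)) (gL 7 ?_ ?_ k8)) (gM 7 ?_ ?_ k8)) (gL 8 ?_ ?_ k9)) (gM 8 ?_ ?_ k9) <;>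
    norm_num

lemma titsB_eq : titsB = ⋃ w ∈ W, (w : V ≃ₗ[ℝ] V) '' PiCone := by
  ext x
  simp only [Set.mem_iUnion, exists_prop]
  constructor
  · intro hx
    obtain ⟨hT, hB⟩ := mem_titsB_iff.1 hx
    obtain ⟨w, hw, hC⟩ := mem_tits_iff.1 hT
    refine ⟨w⁻¹, inv_mem hw, w x, Cbar_inter_Bset_subset_PiCone ⟨hC, hB w hw⟩, ?_⟩
    rw [← LinearEquiv.mul_apply, inv_mul_cancel]; rfl
  · rintro ⟨w, hw, y, hy, rfl⟩
    exact map_mem_titsB hw (PiCone_subset_titsB hy)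

/-- **Theorem `thm:wPiconvex`:** `T ∩ 𝓑 = ⋃_{w∈W} w(Π)`; in particular `W·Π` is
convex. -/
theorem Tits_inter_B_eq_WPi :
    ((⋃ w ∈ W, (w : V ≃ₗ[ℝ] V) '' Cbar) ∩ (⋂ w ∈ W, (w : V ≃ₗ[ℝ] V) ⁻¹' Bset)
      = ⋃ w ∈ W, (w : V ≃ₗ[ℝ] V) '' PiCone)
    ∧ Convex ℝ (⋃ w ∈ W, (w : V ≃ₗ[ℝ] V) '' PiCone) := by
  exact ⟨titsB_eq, titsB_eq ▸ fun _ hx _ hy _ _ ha hb _ =>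
    add_mem_titsB (smul_mem_titsB ha hx) (smul_mem_titsB hb hy)⟩
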